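/- A braid x ∈ B_n with canonical length ℓ(x) > 1 is conjugate to a left rigid braid if and only if it is conjugate to a right rigid braid. -/

import Mathlib

/-!
Axiomatization of Garside groups (positive cone, Garside element, lattice
structure, left/right normal forms), following the paper
"On the cycling operation in braid groups" by Gebhardt and González-Meneses.
-/

namespace Garside

variable {G : Type*} [Group G]

/-- `a ≼ b`: `a` is a left divisor (prefix) of `b` w.r.t. the positive cone `P`. -/
def LeftDvd (P : Submonoid G) (a b : G) : Prop := a⁻¹ * b ∈ P

/-- `a` is a right divisor (suffix) of `b` w.r.t. the positive cone `P`
(i.e. `b ≽ a` in the notation of the paper). -/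
def RightDvd (P : Submonoid G) (a b : G) : Prop := b * a⁻¹ ∈ P

/-- A simple element: a positive prefix of `Δ`. -/
def Simple (P : Submonoid G) (Δ : G) (s : G) : Prop := s ∈ P ∧ LeftDvd P s Δ

/-- An atom: a nontrivial positive element which is not the product
of two nontrivial positive elements. -/
def Atom (P : Submonoid G) (a : G) : Prop :=
  a ∈ P ∧ a ≠ 1 ∧ ∀ b c : G, b ∈ P → c ∈ P → a = b * c → b = 1 ∨ c = 1

/-- `Δ^p x₁ ⋯ x_r` (with `l = [x₁,…,x_r]`) is the left normal form of `x`: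
each factor is a proper simple element and consecutive factors are
left-weighted, `x_i = (x_i x_{i+1}) ∧_L Δ`. -/
def IsLeftNF (P : Submonoid G) (Δ : G) (gcdL : G → G → G) (p : ℤ) (l : List G) (x : G) :
    Prop :=
  x = Δ ^ p * l.prod ∧ (∀ s ∈ l, Simple P Δ s ∧ s ≠ 1 ∧ s ≠ Δ) ∧
    l.Chain' (fun s t => gcdL (s * t) Δ = s)

/-- `y₁ ⋯ y_r Δ^p` (with `l = [y₁,…,y_r]`) is the right normal form of `x`:
each factor is a proper simple element and consecutive factors are
right-weighted, `y_{i+1} = (y_i y_{i+1}) ∧_R Δ`. -/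
def IsRightNF (P : Submonoid G) (Δ : G) (gcdR : G → G → G) (p : ℤ) (l : List G) (x : G) :
    Prop :=
  x = l.prod * Δ ^ p ∧ (∀ s ∈ l, Simple P Δ s ∧ s ≠ 1 ∧ s ≠ Δ) ∧
    l.Chain' (fun s t => gcdR (s * t) Δ = t)

/-- A Garside structure on a group `G`: a positive cone which induces lattice
orders by left and right divisibility, and a Garside element `Δ` whose left and
right divisors coincide (the simple elements), generate the group, and such that
every element admits a unique left and right normal form. -/
structure GarsideGroup (G : Type*) [Group G] where
  pos : Submonoid G
  pos_antisymm : ∀ a : G, a ∈ pos → a⁻¹ ∈ pos → a = 1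
  Δ : G
  Δ_pos : Δ ∈ pos
  gcdL : G → G → G
  gcdL_dvd_left : ∀ a b : G, LeftDvd pos (gcdL a b) a
  gcdL_dvd_right : ∀ a b : G, LeftDvd pos (gcdL a b) b
  dvd_gcdL : ∀ a b c : G, LeftDvd pos c a → LeftDvd pos c b → LeftDvd pos c (gcdL a b)
  lcmL : G → G → G
  dvd_lcmL_left : ∀ a b : G, LeftDvd pos a (lcmL a b)
  dvd_lcmL_right : ∀ a b : G, LeftDvd pos b (lcmL a b)
  lcmL_dvd : ∀ a b c : G, LeftDvd pos a c → LeftDvd pos b c → LeftDvd pos (lcmL a b) c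
  gcdR : G → G → G
  gcdR_dvd_left : ∀ a b : G, RightDvd pos (gcdR a b) a
  gcdR_dvd_right : ∀ a b : G, RightDvd pos (gcdR a b) b
  dvd_gcdR : ∀ a b c : G, RightDvd pos c a → RightDvd pos c b → RightDvd pos c (gcdR a b)
  lcmR : G → G → G
  dvd_lcmR_left : ∀ a b : G, RightDvd pos a (lcmR a b)
  dvd_lcmR_right : ∀ a b : G, RightDvd pos b (lcmR a b)
  lcmR_dvd : ∀ a b c : G, RightDvd pos a c → RightDvd pos b c → RightDvd pos (lcmR a b) c
  divisors_Δ : ∀ s : G, (s ∈ pos ∧ LeftDvd pos s Δ) ↔ (s ∈ pos ∧ RightDvd pos s Δ)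
  simples_generate : Subgroup.closure {s : G | Simple pos Δ s} = ⊤
  lnf_exists : ∀ x : G, ∃ pl : ℤ × List G, IsLeftNF pos Δ gcdL pl.1 pl.2 x
  lnf_unique : ∀ (x : G) (p q : ℤ) (l m : List G),
    IsLeftNF pos Δ gcdL p l x → IsLeftNF pos Δ gcdL q m x → p = q ∧ l = m
  rnf_exists : ∀ x : G, ∃ pl : ℤ × List G, IsRightNF pos Δ gcdR pl.1 pl.2 x
  rnf_unique : ∀ (x : G) (p q : ℤ) (l m : List G),
    IsRightNF pos Δ gcdR p l x → IsRightNF pos Δ gcdR q m x → p = q ∧ l = m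
  lnf_rnf_agree : ∀ (x : G) (p q : ℤ) (l m : List G),
    IsLeftNF pos Δ gcdL p l x → IsRightNF pos Δ gcdR q m x → p = q ∧ l.length = m.length

/-- `L` is the left lcm of the set `S`. -/
def IsLcmL (P : Submonoid G) (S : Set G) (L : G) : Prop :=
  (∀ a ∈ S, LeftDvd P a L) ∧ ∀ c : G, (∀ a ∈ S, LeftDvd P a c) → LeftDvd P L c

/-- A Garside group is atom-friendly (on the left) if `Δ` is the left lcm of the
set of atoms and the starting set of the left lcm of any set `B` of atoms is `B`. -/
def AtomFriendlyL (𝒢 : GarsideGroup G) : Prop :=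
  IsLcmL 𝒢.pos {a : G | Atom 𝒢.pos a} 𝒢.Δ ∧
    ∀ B : Set G, B ⊆ {a : G | Atom 𝒢.pos a} →
      ∃ L : G, IsLcmL 𝒢.pos B L ∧ {a : G | Atom 𝒢.pos a ∧ LeftDvd 𝒢.pos a L} = B

namespace GarsideGroup

variable (𝒢 : GarsideGroup G)

/-- The left normal form of `x`, as a pair (infimum, list of factors). -/
noncomputable def lnf (x : G) : ℤ × List G := Classical.choose (𝒢.lnf_exists x)

/-- The right normal form of `x`, as a pair (exponent of `Δ`, list of factors). -/
noncomputable def rnf (x : G) : ℤ × List G := Classical.choose (𝒢.rnf_exists x)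

/-- `inf x = p`, the maximal `p` with `Δ^p ≼ x`. -/
noncomputable def inf (x : G) : ℤ := (𝒢.lnf x).1

/-- The canonical length `ℓ(x) = r`. -/
noncomputable def len (x : G) : ℕ := (𝒢.lnf x).2.length

/-- `sup x = p + r`. -/
noncomputable def sup (x : G) : ℤ := 𝒢.inf x + 𝒢.len x

/-- `tau 𝒢 k x = τ^k(x) = Δ^{-k} x Δ^k`. -/
def tau (k : ℤ) (x : G) : G := 𝒢.Δ ^ (-k) * x * 𝒢.Δ ^ k

/-- The left initial factor `ι_L(x) = τ^{-p}(x₁)` (equal to `1` if `ℓ(x) = 0`). -/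
noncomputable def iotaL (x : G) : G := 𝒢.tau (-(𝒢.lnf x).1) ((𝒢.lnf x).2.headD 1)

/-- The right initial factor `ι_R(x) = τ^{p}(y_r)` (equal to `1` if `ℓ(x) = 0`). -/
noncomputable def iotaR (x : G) : G := 𝒢.tau (𝒢.rnf x).1 (((𝒢.rnf x).2.getLast?).getD 1)

/-- Left cycling: `c_L(x) = ι_L(x)⁻¹ · x · ι_L(x)`. -/
noncomputable def cL (x : G) : G := (𝒢.iotaL x)⁻¹ * x * 𝒢.iotaL x

/-- Right cycling: `c_R(x) = ι_R(x) · x · ι_R(x)⁻¹`. -/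
noncomputable def cR (x : G) : G := 𝒢.iotaR x * x * (𝒢.iotaR x)⁻¹

/-- `x = Δ^p x₁⋯x_r` (in left normal form, `r > 0`) is left rigid if
`Δ^p x₁⋯x_r ι_L(x)` is in left normal form as written. -/
def LeftRigid (x : G) : Prop :=
  (𝒢.lnf x).2 ≠ [] ∧
    IsLeftNF 𝒢.pos 𝒢.Δ 𝒢.gcdL (𝒢.lnf x).1 ((𝒢.lnf x).2 ++ [𝒢.iotaL x]) (x * 𝒢.iotaL x)

/-- `x = y₁⋯y_r Δ^p` (in right normal form, `r > 0`) is right rigid if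
`ι_R(x) y₁⋯y_r Δ^p` is in right normal form as written. -/
def RightRigid (x : G) : Prop :=
  (𝒢.rnf x).2 ≠ [] ∧
    IsRightNF 𝒢.pos 𝒢.Δ 𝒢.gcdR (𝒢.rnf x).1 (𝒢.iotaR x :: (𝒢.rnf x).2) (𝒢.iotaR x * x)

/-- The super summit set: conjugates of minimal canonical length. -/
def SSS (x : G) : Set G :=
  {y | IsConj x y ∧ ∀ z : G, IsConj x z → 𝒢.len y ≤ 𝒢.len z}

/-- The left ultra summit set. -/
def USSL (x : G) : Set G :=
  {y ∈ 𝒢.SSS x | ∃ t : ℕ, 1 ≤ t ∧ (𝒢.cL)^[t] y = y}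

/-- The right ultra summit set. -/
def USSR (x : G) : Set G :=
  {y ∈ 𝒢.SSS x | ∃ t : ℕ, 1 ≤ t ∧ (𝒢.cR)^[t] y = y}

/-- `x` is periodically geodesic: `inf(x^m) = m inf(x)` and `sup(x^m) = m sup(x)`
for all `m ≥ 1`. -/
def PeriodicallyGeodesic (x : G) : Prop :=
  ∀ m : ℕ, 1 ≤ m → 𝒢.inf (x ^ m) = (m : ℤ) * 𝒢.inf x ∧ 𝒢.sup (x ^ m) = (m : ℤ) * 𝒢.sup x

/-- The left interior `x°_L = x Δ^{-p}`, where `p = inf(x)`. -/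
noncomputable def intL (x : G) : G := x * 𝒢.Δ ^ (-𝒢.inf x)

/-- The right interior `x°_R = Δ^{-p} x`, where `p = inf(x)`. -/
noncomputable def intR (x : G) : G := 𝒢.Δ ^ (-𝒢.inf x) * x

/-- The right transport of `v` (where `v x v⁻¹ = z`):
`v^{(1)}_R = ι_R(z) · v · ι_R(x)⁻¹`. -/
noncomputable def transR (x v : G) : G := 𝒢.iotaR (v * x * v⁻¹) * v * (𝒢.iotaR x)⁻¹

/-- The iterated right transport `v^{(i)}_R` of `v` along the right cyclings of `x`. -/
noncomputable def transRIter (x : G) : ℕ → G → G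
  | 0, v => v
  | i + 1, v => 𝒢.transR ((𝒢.cR)^[i] x) (transRIter x i v)

/-- Arrows of the left ultra summit graph `USG_L(x)`: triples `(u, s, v)` with
`u, v ∈ USS_L(x)`, `s` simple and `s⁻¹ u s = v`. -/
def ArrL (x : G) : Set (G × G × G) :=
  {a | a.1 ∈ 𝒢.USSL x ∧ a.2.2 ∈ 𝒢.USSL x ∧ Simple 𝒢.pos 𝒢.Δ a.2.1 ∧
    a.2.1⁻¹ * a.1 * a.2.1 = a.2.2}

/-- Arrows of the right ultra summit graph `USG_R(x)`: triples `(u, s, v)` with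
`u, v ∈ USS_R(x)`, `s` simple and `s u s⁻¹ = v`. -/
def ArrR (x : G) : Set (G × G × G) :=
  {a | a.1 ∈ 𝒢.USSR x ∧ a.2.2 ∈ 𝒢.USSR x ∧ Simple 𝒢.pos 𝒢.Δ a.2.1 ∧
    a.2.1 * a.1 * a.2.1⁻¹ = a.2.2}

/-- `PathFrom A u l`: the list of arrows `l` forms a directed path in the
graph with arrow set `A`, starting at the vertex `u`. -/
def PathFrom (A : Set (G × G × G)) : G → List (G × G × G) → Prop
  | _, [] => True
  | u, a :: rest => a ∈ A ∧ a.1 = u ∧ PathFrom A a.2.2 rest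

/-- Minimal arrows of `USG_L(x)`: arrows whose label is not a product of the
labels of a directed path of length at least 2 starting at the same vertex. -/
def MinArrL (x : G) : Set (G × G × G) :=
  {a | a ∈ 𝒢.ArrL x ∧ ¬ ∃ l : List (G × G × G), 2 ≤ l.length ∧
    PathFrom (𝒢.ArrL x) a.1 l ∧ (l.map (fun b => b.2.1)).prod = a.2.1}

/-- Minimal arrows of `USG_R(x)`. -/
def MinArrR (x : G) : Set (G × G × G) :=
  {a | a ∈ 𝒢.ArrR x ∧ ¬ ∃ l : List (G × G × G), 2 ≤ l.length ∧
    PathFrom (𝒢.ArrR x) a.1 l ∧ (l.map (fun b => b.2.1)).prod = a.2.1}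

end GarsideGroup

end Garside

namespace Garside

/-- The braid relations on `m` generators `σ₀, …, σ_{m-1}`:
`σᵢσⱼ = σⱼσᵢ` for `|i-j| > 1` and `σᵢσⱼσᵢ = σⱼσᵢσⱼ` for `|i-j| = 1`. -/
def braidRels (m : ℕ) : Set (FreeGroup (Fin m)) :=
  {r | (∃ i j : Fin m, (i : ℕ) + 1 < (j : ℕ) ∧
          r = FreeGroup.of i * FreeGroup.of j * (FreeGroup.of i)⁻¹ * (FreeGroup.of j)⁻¹) ∨
       (∃ i j : Fin m, (i : ℕ) + 1 = (j : ℕ) ∧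
          r = FreeGroup.of i * FreeGroup.of j * FreeGroup.of i *
              (FreeGroup.of j * FreeGroup.of i * FreeGroup.of j)⁻¹)}

/-- Artin's braid group on `n` strands, presented by the `n-1` generators
`σ₁, …, σ_{n-1}` and the braid relations. -/
abbrev BraidGroup (n : ℕ) := PresentedGroup (braidRels (n - 1))

/-- The Artin generators of the braid group. -/
def σB (n : ℕ) (i : Fin (n - 1)) : BraidGroup n :=
  PresentedGroup.of (rels := braidRels (n - 1)) i

/-- The half twist `Δ = σ₁ (σ₂σ₁) ⋯ (σ_{n-1} ⋯ σ₁)`, the Garside element of `Bₙ`. -/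
def halfTwist (n : ℕ) : BraidGroup n :=
  ((List.finRange (n - 1)).map fun k =>
    ((((List.finRange (n - 1)).filter fun j => decide (j ≤ k)).reverse.map (σB n)).prod)).prod

/-- `𝒢` is the (left and right) Garside structure of the braid group `Bₙ`:
the positive cone is the monoid of positive braids, generated by the Artin
generators, and the Garside element is the half twist `Δ`. -/
def IsBraidGarside (n : ℕ) (𝒢 : GarsideGroup (BraidGroup n)) : Prop :=
  𝒢.pos = Submonoid.closure (Set.range (σB n)) ∧ 𝒢.Δ = halfTwist n

end Garside

namespace Garside

section Helpers

variable {G : Type*} [Group G] (𝒢 : GarsideGroup G)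

lemma memEq {P : Submonoid G} {a b : G} (h : a ∈ P) (e : b = a) : b ∈ P := e ▸ h

lemma delta_ne_one : 𝒢.Δ ≠ 1 := by
  intro h
  have h0 : IsLeftNF 𝒢.pos 𝒢.Δ 𝒢.gcdL 0 [] (1 : G) := ⟨by simp, by simp, List.isChain_nil⟩
  have h1 : IsLeftNF 𝒢.pos 𝒢.Δ 𝒢.gcdL 1 [] (1 : G) := ⟨by simp [h], by simp, List.isChain_nil⟩
  have := (𝒢.lnf_unique 1 0 1 [] [] h0 h1).1
  omega

/-- `s, t` left weighted, in terms of divisibility. -/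
def Wt (s t : G) : Prop :=
  ∀ c : G, c⁻¹ * (s * t) ∈ 𝒢.pos → c⁻¹ * 𝒢.Δ ∈ 𝒢.pos → c⁻¹ * s ∈ 𝒢.pos

lemma wt_of_gcd {s t : G} (h : 𝒢.gcdL (s * t) 𝒢.Δ = s) : Wt 𝒢 s t := by
  intro c h1 h2
  have := 𝒢.dvd_gcdL (s * t) 𝒢.Δ c h1 h2
  rw [h] at this
  exact this

lemma dvd_head (l : List G) : ∀ (a c : G), (a :: l).IsChain (Wt 𝒢) →
    (∀ s ∈ a :: l, Simple 𝒢.pos 𝒢.Δ s) → c⁻¹ * (a :: l).prod ∈ 𝒢.pos →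
    c⁻¹ * 𝒢.Δ ∈ 𝒢.pos → c⁻¹ * a ∈ 𝒢.pos := by
  induction l with
  | nil => intro a c _ _ h _; simpa using h
  | cons b l ih =>
    intro a c hch hs hc hcD
    have hsa := hs a (by simp)
    have hap : a⁻¹ * (a :: b :: l).prod ∈ 𝒢.pos := by
      simp only [List.prod_cons, inv_mul_cancel_left]
      refine mul_mem (hs b (by simp)).1 (Submonoid.list_prod_mem _ fun x hx => (hs x (by simp [hx])).1)
    set e := 𝒢.lcmL c a with he
    have hce : c⁻¹ * e ∈ 𝒢.pos := 𝒢.dvd_lcmL_left c a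
    have hae : a⁻¹ * e ∈ 𝒢.pos := 𝒢.dvd_lcmL_right c a
    have heD : e⁻¹ * 𝒢.Δ ∈ 𝒢.pos := 𝒢.lcmL_dvd c a 𝒢.Δ hcD hsa.2
    have hep : e⁻¹ * (a :: b :: l).prod ∈ 𝒢.pos := 𝒢.lcmL_dvd c a _ hc hap
    have hf : (a⁻¹ * 𝒢.Δ) ∈ 𝒢.pos := hsa.2
    have h1 : (a⁻¹ * 𝒢.Δ)⁻¹ * 𝒢.Δ ∈ 𝒢.pos :=
      ((𝒢.divisors_Δ (a⁻¹ * 𝒢.Δ)).2 ⟨hf, by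
        unfold RightDvd; exact memEq hsa.1 (by group)⟩).2
    have h2 : (a⁻¹ * e)⁻¹ * 𝒢.Δ ∈ 𝒢.pos := memEq (mul_mem heD h1) (by group)
    have h3 : (a⁻¹ * e)⁻¹ * (b :: l).prod ∈ 𝒢.pos :=
      memEq hep (by rw [List.prod_cons (a := a)]; group)
    have h4 := ih b (a⁻¹ * e) hch.tail (fun s hs' => hs s (by simp [hs'])) h3 h2
    have hw : Wt 𝒢 a b := by
      rw [List.isChain_cons_cons] at hch; exact hch.1
    have h5 := hw e (memEq h4 (by group)) heD
    exact memEq (mul_mem hce h5) (by group)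

lemma simple_cj {s : G} (hs : Simple 𝒢.pos 𝒢.Δ s) :
    Simple 𝒢.pos 𝒢.Δ (𝒢.Δ * s * 𝒢.Δ⁻¹) ∧ Simple 𝒢.pos 𝒢.Δ (𝒢.Δ⁻¹ * s * 𝒢.Δ) := by
  have hr := ((𝒢.divisors_Δ s).1 hs).2
  have e1 : Simple 𝒢.pos 𝒢.Δ (𝒢.Δ * s⁻¹) := ⟨hr, memEq hs.1 (by group)⟩
  have e2 : Simple 𝒢.pos 𝒢.Δ (s⁻¹ * 𝒢.Δ) :=
    (𝒢.divisors_Δ _).2 ⟨hs.2, memEq hs.1 (by group)⟩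
  have f1 := ((𝒢.divisors_Δ _).1 e1).2
  have f2 := e2.2
  unfold RightDvd at f1
  unfold LeftDvd at f2
  constructor
  · exact ⟨memEq f1 (by group), memEq hr (by group)⟩
  · refine ⟨memEq f2 (by group), ?_⟩
    have g1 := (𝒢.divisors_Δ (𝒢.Δ⁻¹ * s * 𝒢.Δ)).2 ⟨memEq f2 (by group), memEq e2.1 (by group)⟩
    exact g1.2

lemma pos_form {x : G} (hx : x ∈ 𝒢.pos) : ∃ (q : ℕ) (l : List G),
    (∀ s ∈ l, Simple 𝒢.pos 𝒢.Δ s) ∧ x = 𝒢.Δ ^ q * l.prod := by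
  obtain ⟨⟨q, l⟩, h, hs, hc⟩ := 𝒢.lnf_exists x
  simp only at h hs hc
  by_cases hq : 0 ≤ q
  · obtain ⟨k, rfl⟩ := Int.eq_ofNat_of_zero_le hq
    exact ⟨k, l, fun s hs' => (hs s hs').1, by simpa using h⟩
  exfalso
  obtain ⟨k, hk⟩ := Int.eq_ofNat_of_zero_le (show 0 ≤ -q - 1 by omega)
  have h1 : 𝒢.Δ⁻¹ * l.prod ∈ 𝒢.pos := by
    refine memEq (mul_mem (pow_mem 𝒢.Δ_pos k) hx) ?_
    rw [h, ← zpow_natCast, ← mul_assoc, ← zpow_add, ← hk]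
    have : -q - 1 + q = -1 := by ring
    rw [this, zpow_neg_one]
  cases l with
  | nil => exact delta_ne_one 𝒢 (𝒢.pos_antisymm _ 𝒢.Δ_pos (by simpa using h1))
  | cons a l =>
    have h2 := dvd_head 𝒢 l a 𝒢.Δ (List.IsChain.imp (fun _ _ h => wt_of_gcd 𝒢 h) hc)
      (fun s hs' => (hs s hs').1) h1 (by simp)
    obtain ⟨h3, _, h4⟩ := hs a (by simp)
    refine h4 (inv_mul_eq_one.1 (𝒢.pos_antisymm _ h3.2 (memEq h2 (by group))))

lemma cj_mem_one {x : G} (hx : x ∈ 𝒢.pos) :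
    𝒢.Δ * x * 𝒢.Δ⁻¹ ∈ 𝒢.pos ∧ 𝒢.Δ⁻¹ * x * 𝒢.Δ ∈ 𝒢.pos := by
  obtain ⟨q, l, hs, rfl⟩ := pos_form 𝒢 hx
  have key : 𝒢.Δ * l.prod * 𝒢.Δ⁻¹ ∈ 𝒢.pos ∧ 𝒢.Δ⁻¹ * l.prod * 𝒢.Δ ∈ 𝒢.pos := by
    clear hx
    induction l with
    | nil => simp
    | cons a l ih =>
      obtain ⟨h1, h2⟩ := ih (fun s h => hs s (by simp [h]))
      obtain ⟨h3, h4⟩ := simple_cj 𝒢 (hs a (by simp))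
      rw [List.prod_cons]
      exact ⟨memEq (mul_mem h3.1 h1) (by group), memEq (mul_mem h4.1 h2) (by group)⟩
  exact ⟨memEq (mul_mem (pow_mem 𝒢.Δ_pos q) key.1) (by group),
    memEq (mul_mem (pow_mem 𝒢.Δ_pos q) key.2) (by group)⟩

lemma cj_mem (k : ℤ) : ∀ {x : G}, x ∈ 𝒢.pos → 𝒢.Δ ^ k * x * 𝒢.Δ ^ (-k) ∈ 𝒢.pos := by
  induction k using Int.induction_on with
  | zero => intro x hx; simpa using hx
  | succ i ih => intro x hx; exact memEq (cj_mem_one 𝒢 (ih hx)).1 (by group)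
  | pred i ih => intro x hx; exact memEq (cj_mem_one 𝒢 (ih hx)).2 (by group)

lemma delta_swap (k : ℤ) {x : G} (h : x * 𝒢.Δ ^ k ∈ 𝒢.pos) : 𝒢.Δ ^ k * x ∈ 𝒢.pos :=
  memEq (cj_mem 𝒢 k h) (by group)

lemma delta_swap' (k : ℤ) {x : G} (h : 𝒢.Δ ^ k * x ∈ 𝒢.pos) : x * 𝒢.Δ ^ k ∈ 𝒢.pos :=
  memEq (cj_mem 𝒢 (-k) h) (by group)

lemma dpow_mem (k : ℕ) : 𝒢.Δ ^ (k : ℤ) ∈ 𝒢.pos := by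
  rw [zpow_natCast]; exact pow_mem 𝒢.Δ_pos k

lemma dvd_take (l₁ : List G) : ∀ (l₂ : List G) (c : G), (l₁ ++ l₂).IsChain (Wt 𝒢) →
    (∀ s ∈ l₁ ++ l₂, Simple 𝒢.pos 𝒢.Δ s) → c⁻¹ * (l₁ ++ l₂).prod ∈ 𝒢.pos →
    c⁻¹ * 𝒢.Δ ^ (l₁.length : ℤ) ∈ 𝒢.pos → c⁻¹ * l₁.prod ∈ 𝒢.pos := by
  induction l₁ with
  | nil => intro l₂ c _ _ _ h; simpa using h
  | cons a l ih =>
    intro l₂ c hch hs hc hcD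
    have hsa := hs a (by simp)
    have hap : a⁻¹ * (a :: l ++ l₂).prod ∈ 𝒢.pos := by
      simp only [List.cons_append, List.prod_cons, inv_mul_cancel_left]
      exact Submonoid.list_prod_mem _ fun x hx => (hs x (by simp at hx ⊢; tauto)).1
    set k : ℕ := l.length with hk
    have hlen : ((a :: l).length : ℤ) = (k : ℤ) + 1 := by simp [hk]
    rw [hlen] at hcD
    set e := 𝒢.lcmL c a with he
    have hce : c⁻¹ * e ∈ 𝒢.pos := 𝒢.dvd_lcmL_left c a
    have hae : a⁻¹ * e ∈ 𝒢.pos := 𝒢.dvd_lcmL_right c a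
    have haD : a⁻¹ * 𝒢.Δ ^ ((k : ℤ) + 1) ∈ 𝒢.pos :=
      memEq (mul_mem hsa.2 (dpow_mem 𝒢 k)) (by group)
    have heD : e⁻¹ * 𝒢.Δ ^ ((k : ℤ) + 1) ∈ 𝒢.pos := 𝒢.lcmL_dvd c a _ hcD haD
    have hep : e⁻¹ * (a :: l ++ l₂).prod ∈ 𝒢.pos := 𝒢.lcmL_dvd c a _ hc hap
    have h1 := dvd_head 𝒢 (l ++ l₂) a (e * 𝒢.Δ ^ (-(k : ℤ))) hch hs
      (memEq (mul_mem (dpow_mem 𝒢 k) hep) (by rw [List.cons_append]; group))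
      (memEq (cj_mem 𝒢 k heD) (by group))
    have h2 := ih l₂ (a⁻¹ * e) hch.tail (fun s hs' => hs s (by simp at hs' ⊢; tauto))
      (memEq hep (by rw [List.cons_append, List.prod_cons (a := a)]; group))
      (memEq (cj_mem 𝒢 (-k) h1) (by group))
    rw [List.prod_cons]
    exact memEq (mul_mem hce h2) (by group)

/-- A degree function on a Garside group. -/
structure Deg where
  d : G → ℤ
  d_mul : ∀ a b, d (a * b) = d a + d b
  d_pos : ∀ a ∈ 𝒢.pos, a ≠ 1 → 0 < d a
  fin : ∀ k : ℤ, {a : G | a ∈ 𝒢.pos ∧ d a ≤ k}.Finite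

namespace Deg

variable {𝒢} (D : Deg 𝒢)

lemma d_one : D.d 1 = 0 := by
  have := D.d_mul 1 1
  simp at this
  exact this

lemma d_inv (a : G) : D.d a⁻¹ = -D.d a := by
  have := D.d_mul a a⁻¹
  rw [mul_inv_cancel, D.d_one] at this
  omega

lemma d_nonneg {a : G} (h : a ∈ 𝒢.pos) : 0 ≤ D.d a := by
  by_cases h1 : a = 1
  · rw [h1, D.d_one]
  · exact (D.d_pos a h h1).le

lemma eq_one {a : G} (h : a ∈ 𝒢.pos) (h1 : D.d a ≤ 0) : a = 1 := by
  by_contra h2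
  have := D.d_pos a h h2
  omega

lemma d_pow (a : G) (k : ℕ) : D.d (a ^ k) = k * D.d a := by
  induction k with
  | zero => simp [D.d_one]
  | succ k ih => rw [pow_succ, D.d_mul, ih]; push_cast; ring

lemma d_zpow (a : G) (k : ℤ) : D.d (a ^ k) = k * D.d a := by
  cases k with
  | ofNat k => simpa using D.d_pow a k
  | negSucc k =>
    rw [zpow_negSucc, D.d_inv, D.d_pow, Int.negSucc_eq]; push_cast; ring

lemma d_conj (g a : G) : D.d (g * a * g⁻¹) = D.d a := by
  rw [D.d_mul, D.d_mul, D.d_inv]; ring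

/-- Some power of `Δ` is central. -/
lemma exists_central (D : Deg 𝒢) : ∃ N : ℕ, 1 ≤ N ∧ ∀ g : G, Commute (𝒢.Δ ^ (N : ℤ)) g := by
  classical
  have hfin : Finite {s : G // Simple 𝒢.pos 𝒢.Δ s} := by
    refine ((D.fin (D.d 𝒢.Δ)).subset ?_).to_subtype
    intro s hs
    refine ⟨hs.1, ?_⟩
    have h := D.d_nonneg hs.2
    rw [D.d_mul, D.d_inv] at h
    omega
  have hs : ∀ (k : ℕ) (s : G), Simple 𝒢.pos 𝒢.Δ s →
      Simple 𝒢.pos 𝒢.Δ (𝒢.Δ ^ (k : ℤ) * s * 𝒢.Δ ^ (-(k : ℤ))) := by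
    intro k
    induction k with
    | zero => intro s hs; simpa using hs
    | succ k ih =>
      intro s hs
      have := (simple_cj 𝒢 (ih s hs)).1
      convert this using 1
      push_cast
      group
  let f : ℕ → ({s : G // Simple 𝒢.pos 𝒢.Δ s} → {s : G // Simple 𝒢.pos 𝒢.Δ s}) :=
    fun k s => ⟨_, hs k s.1 s.2⟩
  obtain ⟨i, j, hij, hf⟩ : ∃ i j, i < j ∧ f i = f j := by
    obtain ⟨i, j, hne, h⟩ := Finite.exists_ne_map_eq_of_infinite f
    rcases lt_or_gt_of_ne hne with h1 | h1
    · exact ⟨i, j, h1, h⟩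
    · exact ⟨j, i, h1, h.symm⟩
  refine ⟨j - i, by omega, ?_⟩
  have hcast : ((j - i : ℕ) : ℤ) = (j : ℤ) - i := by omega
  rw [hcast]
  have hsub : Subgroup.closure {s : G | Simple 𝒢.pos 𝒢.Δ s} ≤
      Subgroup.centralizer {𝒢.Δ ^ ((j : ℤ) - i)} := by
    rw [Subgroup.closure_le]
    intro s hs'
    have h1 : (f i ⟨s, hs'⟩).1 = (f j ⟨s, hs'⟩).1 := by rw [hf]
    simp only [f] at h1
    rw [SetLike.mem_coe, Subgroup.mem_centralizer_iff]
    intro h hh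
    rw [Set.mem_singleton_iff] at hh
    subst hh
    have h2 : 𝒢.Δ ^ (-(i : ℤ)) * (𝒢.Δ ^ (j : ℤ) * s * 𝒢.Δ ^ (-(j : ℤ))) * 𝒢.Δ ^ (j : ℤ) =
      𝒢.Δ ^ (-(i : ℤ)) * (𝒢.Δ ^ (i : ℤ) * s * 𝒢.Δ ^ (-(i : ℤ))) * 𝒢.Δ ^ (j : ℤ) := by rw [h1]
    calc _ = 𝒢.Δ ^ (-(i : ℤ)) * (𝒢.Δ ^ (j : ℤ) * s * 𝒢.Δ ^ (-(j : ℤ))) * 𝒢.Δ ^ (j : ℤ) := by group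
      _ = _ := by rw [h2]; group
  rw [𝒢.simples_generate] at hsub
  intro g
  have := hsub (Subgroup.mem_top g)
  rw [Subgroup.mem_centralizer_iff] at this
  exact this _ rfl

end Deg

section Rigid

variable (p : ℤ) (r N : ℕ)

/-- The central twist `Δ^{-Np} y^N`. -/
def vv (y : G) : G := 𝒢.Δ ^ (-((N : ℤ) * p)) * y ^ N

/-- `inf y ≥ p` and `sup y ≤ p + r`. -/
def Adm (y : G) : Prop := 𝒢.Δ ^ (-p) * y ∈ 𝒢.pos ∧ y⁻¹ * 𝒢.Δ ^ (p + r) ∈ 𝒢.pos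

/-- `c` is a suffix of some power of `vv y`. -/
def Suf (y c : G) : Prop := ∃ M : ℕ, vv 𝒢 p N y ^ M * c⁻¹ ∈ 𝒢.pos

/-- `R` is the largest common suffix of `Δ^k` and of the powers of `vv y`. -/
def IsR (y : G) (k : ℕ) (R : G) : Prop :=
  Suf 𝒢 p N y R ∧ 𝒢.Δ ^ (k : ℤ) * R⁻¹ ∈ 𝒢.pos ∧
    ∀ c : G, Suf 𝒢 p N y c → 𝒢.Δ ^ (k : ℤ) * c⁻¹ ∈ 𝒢.pos → R * c⁻¹ ∈ 𝒢.pos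

variable {p r N}

lemma vv_pow (hcen : ∀ g : G, Commute (𝒢.Δ ^ ((N : ℤ) * p)) g)
    (y : G) (m : ℕ) :
    vv 𝒢 p N y ^ m = 𝒢.Δ ^ (-(((N * m : ℕ) : ℤ) * p)) * y ^ (N * m) := by
  have hc : Commute (𝒢.Δ ^ (-((N : ℤ) * p))) (y ^ N) := by
    rw [zpow_neg]; exact (hcen _).inv_left
  unfold vv
  rw [hc.mul_pow, ← pow_mul, ← zpow_natCast, ← zpow_mul]
  congr 2
  push_cast
  ring

lemma vv_conj (hcen : ∀ g : G, Commute (𝒢.Δ ^ ((N : ℤ) * p)) g)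
    (g y : G) : vv 𝒢 p N (g * y * g⁻¹) = g * vv 𝒢 p N y * g⁻¹ := by
  have hc : Commute (𝒢.Δ ^ (-((N : ℤ) * p))) g := by
    rw [zpow_neg]; exact (hcen _).inv_left
  unfold vv
  rw [conj_pow, ← mul_assoc, ← mul_assoc, hc.eq]
  group

lemma vv_comm (hcen : ∀ g : G, Commute (𝒢.Δ ^ ((N : ℤ) * p)) g)
    {y t : G} (ht : Commute t y) : Commute t (vv 𝒢 p N y) := by
  unfold vv
  refine Commute.mul_right ?_ (ht.pow_right N)
  rw [zpow_neg]
  exact ((hcen _).inv_left).symm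

lemma adm_pow {y : G} (hy : Adm 𝒢 p r y) (m : ℕ) :
    𝒢.Δ ^ (-((m : ℤ) * p)) * y ^ m ∈ 𝒢.pos := by
  induction m with
  | zero => simp
  | succ m ih =>
    refine memEq (mul_mem (cj_mem 𝒢 (-p) ih) hy.1) ?_
    rw [pow_succ]; push_cast; group

lemma adm_pow' {y : G} (hy : Adm 𝒢 p r y) (m : ℕ) :
    (y ^ m)⁻¹ * 𝒢.Δ ^ ((m : ℤ) * (p + r)) ∈ 𝒢.pos := by
  induction m with
  | zero => simp
  | succ m ih =>
    refine memEq (mul_mem hy.2 (cj_mem 𝒢 (-(p + r)) ih)) ?_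
    rw [pow_succ, mul_inv_rev]
    have : ((m + 1 : ℕ) : ℤ) * (p + r) = (m : ℤ) * (p + r) + (p + r) := by push_cast; ring
    rw [this, zpow_add]
    simp only [neg_neg, zpow_neg]
    group

lemma vv_mem {y : G} (hy : Adm 𝒢 p r y) : vv 𝒢 p N y ∈ 𝒢.pos := adm_pow 𝒢 hy N

lemma vv_sup (hcen : ∀ g : G, Commute (𝒢.Δ ^ ((N : ℤ) * p)) g)
    {y : G} (hy : Adm 𝒢 p r y) (m : ℕ) :
    (vv 𝒢 p N y ^ m)⁻¹ * 𝒢.Δ ^ ((m * (N * r) : ℕ) : ℤ) ∈ 𝒢.pos := by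
  rw [vv_pow 𝒢 hcen]
  refine memEq (adm_pow' 𝒢 hy (N * m)) ?_
  rw [mul_inv_rev, mul_assoc, ← zpow_neg, ← zpow_add]
  congr 2
  push_cast
  ring

lemma suf_mono {y c : G} (hy : Adm 𝒢 p r y) {M M' : ℕ} (h : M ≤ M')
    (hc : vv 𝒢 p N y ^ M * c⁻¹ ∈ 𝒢.pos) : vv 𝒢 p N y ^ M' * c⁻¹ ∈ 𝒢.pos := by
  obtain ⟨k, rfl⟩ := Nat.exists_eq_add_of_le h
  rw [add_comm, pow_add, mul_assoc]
  exact mul_mem (pow_mem (vv_mem 𝒢 hy) k) hc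

lemma suf_one (y : G) : Suf 𝒢 p N y 1 := ⟨0, by simp⟩

lemma exists_isR (D : Deg 𝒢) {y : G} (hy : Adm 𝒢 p r y) (k : ℕ) :
    ∃ R, IsR 𝒢 p N y k R := by
  have hb : ∃ b : ℤ, ∀ z : ℤ, (∃ c : G, Suf 𝒢 p N y c ∧ 𝒢.Δ ^ (k : ℤ) * c⁻¹ ∈ 𝒢.pos ∧ D.d c = z) →
      z ≤ b := by
    refine ⟨D.d (𝒢.Δ ^ (k : ℤ)), ?_⟩
    rintro z ⟨c, _, h, rfl⟩
    have := D.d_nonneg h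
    rw [D.d_mul, D.d_inv] at this
    omega
  obtain ⟨z, ⟨R, hR, hRk, hRz⟩, hmax⟩ := Int.exists_greatest_of_bdd hb
    ⟨_, 1, suf_one 𝒢 y, by simpa using dpow_mem 𝒢 k, rfl⟩
  refine ⟨R, hR, hRk, ?_⟩
  intro c hc hck
  obtain ⟨M1, h1⟩ := hR
  obtain ⟨M2, h2⟩ := hc
  have h1' := suf_mono 𝒢 hy (le_max_left M1 M2) h1
  have h2' := suf_mono 𝒢 hy (le_max_right M1 M2) h2
  set M := max M1 M2
  set g := 𝒢.gcdR (vv 𝒢 p N y ^ M) (𝒢.Δ ^ (k : ℤ)) with hg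
  have g1 : g * R⁻¹ ∈ 𝒢.pos := 𝒢.dvd_gcdR _ _ _ h1' hRk
  have g2 : g * c⁻¹ ∈ 𝒢.pos := 𝒢.dvd_gcdR _ _ _ h2' hck
  have g3 := hmax (D.d g) ⟨g, ⟨M, 𝒢.gcdR_dvd_left _ _⟩, 𝒢.gcdR_dvd_right _ _, rfl⟩
  have g4 : g * R⁻¹ = 1 := D.eq_one g1 (by rw [D.d_mul, D.d_inv]; omega)
  rw [mul_inv_eq_one] at g4
  rw [← g4]
  exact g2

lemma isR_unique {y R R' : G} {k : ℕ} (h : IsR 𝒢 p N y k R) (h' : IsR 𝒢 p N y k R') :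
    R = R' := by
  have h1 := h.2.2 R' h'.1 h'.2.1
  have h2 := h'.2.2 R h.1 h.2.1
  rw [← mul_inv_eq_one]
  exact 𝒢.pos_antisymm _ h1 (memEq h2 (by group))

lemma isR_pos {y R : G} {k : ℕ} (h : IsR 𝒢 p N y k R) : R ∈ 𝒢.pos := by
  simpa using h.2.2 1 (suf_one 𝒢 y) (by simpa using dpow_mem 𝒢 k)

lemma isR_zero (y : G) : IsR 𝒢 p N y 0 1 := by
  refine ⟨suf_one 𝒢 y, by simp, ?_⟩
  intro c _ h
  simpa using h

lemma isR_conj_aux {y R g : G} {k : ℕ} {e : ℤ} (h : IsR 𝒢 p N y k R)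
    (hg : Commute g (vv 𝒢 p N y)) (hge : 𝒢.Δ ^ (-e) * g ∈ 𝒢.pos) :
    𝒢.Δ ^ (-e) * (R * g * R⁻¹) ∈ 𝒢.pos := by
  obtain ⟨⟨M, hM⟩, hk, hmax⟩ := h
  have hge' := delta_swap' 𝒢 (-e) hge
  have := hmax (𝒢.Δ ^ e * R * g⁻¹) ⟨M, ?_⟩ ?_
  · apply delta_swap
    refine memEq this ?_
    group
  · have hc : vv 𝒢 p N y ^ M * g = g * vv 𝒢 p N y ^ M := (hg.pow_right M).eq.symm
    refine memEq (mul_mem hge' (cj_mem 𝒢 e hM)) ?_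
    calc _ = (vv 𝒢 p N y ^ M * g) * R⁻¹ * 𝒢.Δ ^ (-e) := by group
      _ = _ := by rw [hc]; group
  · refine memEq (mul_mem (cj_mem 𝒢 k hge') (cj_mem 𝒢 e hk)) ?_
    have : 𝒢.Δ ^ e * (𝒢.Δ ^ (k : ℤ) * R⁻¹) * 𝒢.Δ ^ (-e) =
      𝒢.Δ ^ (k : ℤ) * (𝒢.Δ ^ e * R⁻¹ * 𝒢.Δ ^ (-e)) := by
      rw [← mul_assoc, ← zpow_add, add_comm, zpow_add]; group
    rw [this]
    group

lemma isR_adm (hcen : ∀ g : G, Commute (𝒢.Δ ^ ((N : ℤ) * p)) g)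
    {y R : G} {k : ℕ} (hy : Adm 𝒢 p r y) (h : IsR 𝒢 p N y k R) :
    Adm 𝒢 p r (R * y * R⁻¹) := by
  have hc : Commute y (vv 𝒢 p N y) := vv_comm 𝒢 hcen (Commute.refl y)
  refine ⟨isR_conj_aux 𝒢 h hc hy.1, ?_⟩
  have h1 := isR_conj_aux 𝒢 (g := y⁻¹) (e := -(p + r)) h hc.inv_left
    (by rw [neg_neg]; exact delta_swap 𝒢 _ hy.2)
  rw [neg_neg] at h1
  exact memEq (delta_swap' 𝒢 _ h1) (by group)

lemma isR_shift (hcen : ∀ g : G, Commute (𝒢.Δ ^ ((N : ℤ) * p)) g)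
    {y R R' : G} {j k : ℕ} (h : IsR 𝒢 p N y j R)
    (h' : IsR 𝒢 p N (R * y * R⁻¹) k R') : IsR 𝒢 p N y (j + k) (R' * R) := by
  have hRpos := isR_pos 𝒢 h
  obtain ⟨⟨M, hM⟩, hj, hmax⟩ := h
  obtain ⟨⟨M', hM'⟩, hk, hmax'⟩ := h'
  rw [vv_conj 𝒢 hcen, conj_pow] at hM'
  refine ⟨⟨M + M', ?_⟩, ?_, ?_⟩
  · refine memEq (mul_mem hM hM') ?_
    rw [pow_add]; group
  · refine memEq (mul_mem (cj_mem 𝒢 k hj) hk) ?_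
    rw [Nat.cast_add, add_comm, zpow_add]; group
  · rintro c ⟨L, hL⟩ hc
    have hc' : 𝒢.Δ ^ (j : ℤ) * c⁻¹ * 𝒢.Δ ^ (k : ℤ) ∈ 𝒢.pos := by
      refine memEq (cj_mem 𝒢 (-k) hc) ?_
      rw [Nat.cast_add, add_comm, zpow_add]; group
    have h1 := hmax (𝒢.Δ ^ (-(k : ℤ)) * c)
      ⟨L, memEq (mul_mem hL (dpow_mem 𝒢 k)) (by group)⟩ (memEq hc' (by group))
    have h2 := hmax' (c * R⁻¹) ⟨L, ?_⟩ ?_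
    · exact memEq h2 (by group)
    · rw [vv_conj 𝒢 hcen, conj_pow]
      exact memEq (mul_mem hRpos hL) (by group)
    · refine memEq (cj_mem 𝒢 k h1) (by group)

lemma suf_grow (hN : 1 ≤ N) (hcen : ∀ g : G, Commute (𝒢.Δ ^ ((N : ℤ) * p)) g) {y R : G}
    (hy : Adm 𝒢 p r y) (h : Suf 𝒢 p N y R) : Suf 𝒢 p N y (𝒢.Δ ^ (-p) * R * y) := by
  obtain ⟨M, hM⟩ := h
  refine ⟨M + 1, ?_⟩
  have hc : Commute y (vv 𝒢 p N y) := vv_comm 𝒢 hcen (Commute.refl y)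
  obtain ⟨n, rfl⟩ : ∃ n, N = n + 1 := ⟨N - 1, by omega⟩
  have h1 := adm_pow 𝒢 hy n
  have hv : vv 𝒢 p (n + 1) y * y⁻¹ = 𝒢.Δ ^ (-p) * (𝒢.Δ ^ (-((n : ℤ) * p)) * y ^ n) := by
    unfold vv
    rw [pow_succ]
    push_cast
    group
  have hc' : vv 𝒢 p (n + 1) y ^ M * y⁻¹ = y⁻¹ * vv 𝒢 p (n + 1) y ^ M :=
    ((hc.inv_left).pow_right M).eq.symm
  have h2 := mul_mem h1 hM
  refine memEq (cj_mem 𝒢 (-p) h2) ?_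
  calc vv 𝒢 p (n + 1) y ^ (M + 1) * (𝒢.Δ ^ (-p) * R * y)⁻¹
      = vv 𝒢 p (n + 1) y * (vv 𝒢 p (n + 1) y ^ M * y⁻¹) * R⁻¹ * 𝒢.Δ ^ p := by
        rw [pow_succ']; group
    _ = (vv 𝒢 p (n + 1) y * y⁻¹) * vv 𝒢 p (n + 1) y ^ M * R⁻¹ * 𝒢.Δ ^ p := by
        rw [hc']; group
    _ = _ := by rw [hv]; group

lemma isR_grow (hcen : ∀ g : G, Commute (𝒢.Δ ^ ((N : ℤ) * p)) g)
    (hN : 1 ≤ N) {y R R' : G} {k : ℕ}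
    (hy : Adm 𝒢 p r y) (h : IsR 𝒢 p N y k R) (h' : IsR 𝒢 p N y (k + r) R') :
    R' * (𝒢.Δ ^ (-p) * R * y)⁻¹ ∈ 𝒢.pos := by
  refine h'.2.2 _ (suf_grow 𝒢 hN hcen hy h.1) ?_
  have h1 : 𝒢.Δ ^ (r : ℤ) * y⁻¹ * 𝒢.Δ ^ p ∈ 𝒢.pos := by
    refine memEq (cj_mem 𝒢 r hy.2) ?_
    rw [zpow_add]; group
  refine memEq (mul_mem (cj_mem 𝒢 k h1) (cj_mem 𝒢 (-p + k) (delta_swap' 𝒢 _ h.2.1))) ?_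
  rw [Nat.cast_add, zpow_add]; group

end Rigid

lemma simple_cjk (k : ℤ) {s : G} (hs : Simple 𝒢.pos 𝒢.Δ s) :
    Simple 𝒢.pos 𝒢.Δ (𝒢.Δ ^ k * s * 𝒢.Δ ^ (-k)) :=
  ⟨cj_mem 𝒢 k hs.1, memEq (cj_mem 𝒢 k hs.2) (by group)⟩

lemma wt_cj (k : ℤ) {s t : G} (h : Wt 𝒢 s t) :
    Wt 𝒢 (𝒢.Δ ^ k * s * 𝒢.Δ ^ (-k)) (𝒢.Δ ^ k * t * 𝒢.Δ ^ (-k)) := by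
  intro c h1 h2
  have := h (𝒢.Δ ^ (-k) * c * 𝒢.Δ ^ k) (memEq (cj_mem 𝒢 (-k) h1) (by group))
    (memEq (cj_mem 𝒢 (-k) h2) (by group))
  exact memEq (cj_mem 𝒢 k this) (by group)

lemma cj_prod (k : ℤ) (l : List G) :
    (l.map fun g => 𝒢.Δ ^ k * g * 𝒢.Δ ^ (-k)).prod = 𝒢.Δ ^ k * l.prod * 𝒢.Δ ^ (-k) := by
  induction l with
  | nil => simp
  | cons a l ih => rw [List.map_cons, List.prod_cons, ih, List.prod_cons]; group

lemma prod_sup (l : List G) (hl : ∀ s ∈ l, Simple 𝒢.pos 𝒢.Δ s) :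
    l.prod⁻¹ * 𝒢.Δ ^ (l.length : ℤ) ∈ 𝒢.pos := by
  induction l with
  | nil => simp
  | cons a l ih =>
    refine memEq (mul_mem (ih fun s h => hl s (by simp [h]))
      (cj_mem 𝒢 (-(l.length : ℤ)) (hl a (by simp)).2)) ?_
    rw [List.prod_cons, List.length_cons]
    push_cast
    group

/-- The concatenation of `m` twisted copies of `l`. -/
def LL (p : ℤ) (l : List G) : ℕ → List G
  | 0 => []
  | m + 1 => LL p l m ++
      l.map fun g => 𝒢.Δ ^ (((m + 1 : ℕ) : ℤ) * p) * g * 𝒢.Δ ^ (-(((m + 1 : ℕ) : ℤ) * p))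

lemma LL_prod (p : ℤ) (l : List G) (m : ℕ) :
    (LL 𝒢 p l m).prod = (𝒢.Δ ^ p * l.prod) ^ m * 𝒢.Δ ^ (-((m : ℤ) * p)) := by
  induction m with
  | zero => simp [LL]
  | succ m ih =>
    rw [LL, List.prod_append, ih, cj_prod, pow_succ]
    push_cast
    group

lemma LL_length (p : ℤ) (l : List G) (m : ℕ) : (LL 𝒢 p l m).length = m * l.length := by
  induction m with
  | zero => simp [LL]
  | succ m ih => rw [LL, List.length_append, ih, List.length_map]; ring

lemma LL_proper (p : ℤ) (l : List G) (hl : ∀ s ∈ l, Simple 𝒢.pos 𝒢.Δ s ∧ s ≠ 1 ∧ s ≠ 𝒢.Δ)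
    (m : ℕ) : ∀ s ∈ LL 𝒢 p l m, Simple 𝒢.pos 𝒢.Δ s ∧ s ≠ 1 ∧ s ≠ 𝒢.Δ := by
  induction m with
  | zero => simp [LL]
  | succ m ih =>
    intro s hs
    rw [LL, List.mem_append] at hs
    rcases hs with hs | hs
    · exact ih s hs
    · obtain ⟨g, hg, rfl⟩ := List.mem_map.1 hs
      obtain ⟨h1, h2, h3⟩ := hl g hg
      generalize (((m + 1 : ℕ) : ℤ) * p) = k
      refine ⟨simple_cjk 𝒢 _ h1, ?_, ?_⟩
      · intro h
        apply h2
        calc g = 𝒢.Δ ^ (-k) * (𝒢.Δ ^ k * g * 𝒢.Δ ^ (-k)) * 𝒢.Δ ^ k := by group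
          _ = 1 := by rw [h]; group
      · intro h
        apply h3
        calc g = 𝒢.Δ ^ (-k) * (𝒢.Δ ^ k * g * 𝒢.Δ ^ (-k)) * 𝒢.Δ ^ k := by group
          _ = 𝒢.Δ := by rw [h]; group

lemma LL_chain (p : ℤ) (l : List G)
    (hl : (l ++ [𝒢.Δ ^ p * l.headD 1 * 𝒢.Δ ^ (-p)]).IsChain (Wt 𝒢)) (m : ℕ) :
    (LL 𝒢 p l m).IsChain (Wt 𝒢) := by
  rw [List.isChain_append] at hl
  obtain ⟨hl1, -, hl2⟩ := hl
  induction m with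
  | zero => simp [LL]
  | succ m ih =>
    rw [LL, List.isChain_append]
    refine ⟨ih, ?_, ?_⟩
    · rw [List.isChain_map]
      exact hl1.imp fun _ _ h => wt_cj 𝒢 _ h
    · intro s hs t ht
      cases m with
      | zero => simp [LL] at hs
      | succ m =>
        cases l with
        | nil => simp at ht
        | cons a l =>
          rw [LL, List.getLast?_append_of_ne_nil _ (by simp), List.getLast?_map] at hs
          obtain ⟨b, hb, rfl⟩ := Option.mem_map.1 hs
          have ht' : t = 𝒢.Δ ^ (((m + 1 + 1 : ℕ) : ℤ) * p) * a *
              𝒢.Δ ^ (-(((m + 1 + 1 : ℕ) : ℤ) * p)) := by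
            simpa [eq_comm] using ht
          rw [ht']
          have h1 := wt_cj 𝒢 (((m + 1 : ℕ) : ℤ) * p) (hl2 b hb _ (by simp; rfl))
          convert h1 using 1
          push_cast
          group

lemma LL_prefix (p : ℤ) (l : List G) (m k : ℕ) : ∃ l', LL 𝒢 p l (m + k) = LL 𝒢 p l m ++ l' := by
  induction k with
  | zero => exact ⟨[], by simp⟩
  | succ k ih =>
    obtain ⟨l', h⟩ := ih
    rw [← add_assoc, LL, h, List.append_assoc]
    exact ⟨_, rfl⟩

/-- Consequences of left rigidity used in the proof. -/
lemma rigid_data (D : Deg 𝒢) {x : G} (hx : 𝒢.LeftRigid x) : ∃ (p : ℤ) (r : ℕ), Adm 𝒢 p r x ∧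
    0 < D.d x - p * D.d 𝒢.Δ ∧
    ∀ N : ℕ, (∀ g : G, Commute (𝒢.Δ ^ ((N : ℤ) * p)) g) →
      (∀ (M m : ℕ) (c : G), c⁻¹ * vv 𝒢 p N x ^ M ∈ 𝒢.pos →
        c⁻¹ * 𝒢.Δ ^ ((m * (N * r) : ℕ) : ℤ) ∈ 𝒢.pos → c⁻¹ * vv 𝒢 p N x ^ m ∈ 𝒢.pos) ∧
      ∀ M : ℕ, 𝒢.Δ⁻¹ * vv 𝒢 p N x ^ M ∉ 𝒢.pos := by
  obtain ⟨hne, -, -, hch⟩ := hx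
  obtain ⟨hxe, hpr, -⟩ : IsLeftNF 𝒢.pos 𝒢.Δ 𝒢.gcdL (𝒢.lnf x).1 (𝒢.lnf x).2 x :=
    Classical.choose_spec (𝒢.lnf_exists x)
  unfold GarsideGroup.iotaL GarsideGroup.tau at hch
  rw [neg_neg] at hch
  generalize (𝒢.lnf x).1 = p at *
  generalize (𝒢.lnf x).2 = l at *
  have hch' := List.IsChain.imp (fun _ _ h => wt_of_gcd 𝒢 h) hch
  have hsim : ∀ s ∈ l, Simple 𝒢.pos 𝒢.Δ s := fun s hs => (hpr s hs).1
  have hadm : Adm 𝒢 p l.length x := by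
    constructor
    · rw [hxe]
      refine memEq (Submonoid.list_prod_mem _ fun s hs => (hsim s hs).1) (by group)
    · refine memEq (prod_sup 𝒢 l hsim) ?_
      rw [hxe, zpow_add]; group
  refine ⟨p, l.length, hadm, ?_, ?_⟩
  · have h1 : D.d x = p * D.d 𝒢.Δ + D.d l.prod := by
      rw [hxe, D.d_mul, D.d_zpow]
    cases l with
    | nil => exact absurd rfl hne
    | cons a l =>
      rw [List.prod_cons, D.d_mul] at h1
      have h2 := D.d_pos a (hsim a (by simp)).1 (hpr a (by simp)).2.1
      have h3 := D.d_nonneg (Submonoid.list_prod_mem 𝒢.pos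
        fun s (hs : s ∈ l) => (hsim s (by simp [hs])).1)
      omega
  · intro N hcen
    have hv : ∀ M, vv 𝒢 p N x ^ M = (LL 𝒢 p l (N * M)).prod := by
      intro M
      rw [vv_pow 𝒢 hcen, LL_prod, ← hxe]
      have : Commute (𝒢.Δ ^ (-(((N * M : ℕ) : ℤ) * p))) (x ^ (N * M)) := by
        have := ((hcen (x ^ (N * M))).zpow_left (-(M : ℤ)))
        rw [← zpow_mul] at this
        convert this using 2
        push_cast
        ring
      exact this.eq
    have hLL := LL_proper 𝒢 p l hpr
    constructor
    · intro M m c h1 h2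
      rcases le_total m M with hmM | hmM
      · obtain ⟨k, rfl⟩ := Nat.exists_eq_add_of_le hmM
        obtain ⟨l', hl'⟩ := LL_prefix 𝒢 p l (N * m) (N * k)
        have hchM := LL_chain 𝒢 p l hch' (N * (m + k))
        have hprM := hLL (N * (m + k))
        rw [hv] at h1
        rw [hv]
        rw [Nat.mul_add, hl'] at h1 hchM hprM
        refine dvd_take 𝒢 _ l' c hchM (fun s hs => (hprM s hs).1) h1 ?_
        rw [LL_length]
        convert h2 using 4
        ring
      · obtain ⟨k, rfl⟩ := Nat.exists_eq_add_of_le hmM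
        rw [pow_add, ← mul_assoc]
        exact mul_mem h1 (pow_mem (vv_mem 𝒢 hadm) k)
    · intro M h
      rw [hv] at h
      have hchM := LL_chain 𝒢 p l hch' (N * M)
      have hprM := hLL (N * M)
      generalize LL 𝒢 p l (N * M) = L at *
      cases L with
      | nil => exact delta_ne_one 𝒢 (𝒢.pos_antisymm _ 𝒢.Δ_pos (by simpa using h))
      | cons a L =>
        have h2 := dvd_head 𝒢 L a 𝒢.Δ hchM (fun s hs' => (hprM s hs').1) h (by simp)
        obtain ⟨h3, _, h4⟩ := hprM a (by simp)
        exact h4 (inv_mul_eq_one.1 (𝒢.pos_antisymm _ h3.2 (memEq h2 (by group))))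

/-- The core of the argument: the limit right cycling reaches an element `y`
whose right normal form is compatible with that of its powers. -/
lemma core (D : Deg 𝒢) {x : G} {p : ℤ} {r N : ℕ} (hN : 1 ≤ N)
    (hcen : ∀ g : G, Commute (𝒢.Δ ^ ((N : ℤ) * p)) g)
    (hx : Adm 𝒢 p r x) 
    (hA : ∀ (M m : ℕ) (c : G), c⁻¹ * vv 𝒢 p N x ^ M ∈ 𝒢.pos →
        c⁻¹ * 𝒢.Δ ^ ((m * (N * r) : ℕ) : ℤ) ∈ 𝒢.pos → c⁻¹ * vv 𝒢 p N x ^ m ∈ 𝒢.pos)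
    (hB : ∀ M : ℕ, 𝒢.Δ⁻¹ * vv 𝒢 p N x ^ M ∉ 𝒢.pos) :
    ∃ R : G, Adm 𝒢 p r (R * x * R⁻¹) ∧
      IsR 𝒢 p N (R * x * R⁻¹) r (𝒢.Δ ^ (-p) * (R * x * R⁻¹)) ∧
      ¬ Suf 𝒢 p N (R * x * R⁻¹) 𝒢.Δ := by
  choose S hS using fun m : ℕ => exists_isR (N := N) 𝒢 D hx (m * r)
  have hSadm : ∀ m, Adm 𝒢 p r (S m * x * (S m)⁻¹) := fun m => isR_adm 𝒢 hcen hx (hS m)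
  -- pigeonhole
  have hfin : Set.Finite {y : G | Adm 𝒢 p r y} := by
    have h1 := (D.fin (D.d (𝒢.Δ ^ (r : ℤ)))).image (fun a => 𝒢.Δ ^ p * a)
    refine h1.subset ?_
    intro y hy
    refine ⟨𝒢.Δ ^ (-p) * y, ⟨hy.1, ?_⟩, by group⟩
    have h2 := D.d_nonneg hy.2
    simp only [D.d_mul, D.d_inv, D.d_zpow] at h2 ⊢
    linarith
  obtain ⟨i, j, hij, heq⟩ : ∃ i j, i < j ∧ S i * x * (S i)⁻¹ = S j * x * (S j)⁻¹ := by
    have : Finite {y : G | Adm 𝒢 p r y} := hfin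
    obtain ⟨i, j, hne, h⟩ := Finite.exists_ne_map_eq_of_infinite
      (fun m : ℕ => (⟨_, hSadm m⟩ : {y : G | Adm 𝒢 p r y}))
    have h' := congrArg Subtype.val h
    rcases lt_or_gt_of_ne hne with h1 | h1
    · exact ⟨i, j, h1, h'⟩
    · exact ⟨j, i, h1, h'.symm⟩
  have hSi := hS i
  have hy := hSadm i
  set R := S i with hR
  set y := R * x * R⁻¹ with hydef
  obtain ⟨a, rfl⟩ : ∃ a, j = i + (a + 1) := ⟨j - i - 1, by omega⟩
  obtain ⟨T, hT⟩ := exists_isR (N := N) 𝒢 D hy ((a + 1) * r)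
  have hTR : T * R = S (i + (a + 1)) := by
    have h1 := isR_shift 𝒢 hcen hSi hT
    rw [← add_mul] at h1
    exact isR_unique 𝒢 h1 (hS _)
  have hTy : T * y * T⁻¹ = y := by
    calc T * y * T⁻¹ = (T * R) * x * (T * R)⁻¹ := by rw [hydef]; group
      _ = y := by rw [hTR, ← heq]
  have hTc : Commute T y := by
    rw [mul_inv_eq_iff_eq_mul] at hTy
    exact hTy
  have hTk : ∀ k : ℕ, IsR 𝒢 p N y (k * ((a + 1) * r)) (T ^ k) := by
    intro k
    induction k with
    | zero => simpa using isR_zero (p := p) (N := N) 𝒢 y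
    | succ k ih =>
      have h1 := isR_shift 𝒢 hcen (R' := T ^ k) hT (by rw [hTy]; exact ih)
      rw [← pow_succ] at h1
      convert h1 using 1
      ring
  have hdy : D.d y = D.d x := D.d_conj _ _
  set δ := D.d x - p * D.d 𝒢.Δ with hδ
  have hdv : D.d (vv 𝒢 p N x) = N * δ := by
    unfold vv
    rw [D.d_mul, D.d_zpow, D.d_pow, hδ]; ring
  -- comparison of x and y
  obtain ⟨j0, hQ⟩ := hSi.1
  set Q := vv 𝒢 p N x ^ j0 * R⁻¹ with hQdef
  have hRpos := isR_pos 𝒢 hSi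
  have hQv : ∀ M, Q * vv 𝒢 p N y ^ M * R = vv 𝒢 p N x ^ (j0 + M) := by
    intro M
    rw [hydef, vv_conj 𝒢 hcen, conj_pow, hQdef, pow_add]; group
  have hTle : D.d T ≤ (a + 1) * δ := by
    by_contra hlt
    push Not at hlt
    have hbd : ∀ k : ℕ, ((N * k : ℕ) : ℤ) * D.d T ≤ ((j0 + k * (a + 1) : ℕ) : ℤ) * (N * δ) := by
      intro k
      obtain ⟨⟨M, hM⟩, hsup, -⟩ := hTk (N * k)
      have hcomm : vv 𝒢 p N y ^ M * (T ^ (N * k))⁻¹ = (T ^ (N * k))⁻¹ * vv 𝒢 p N y ^ M :=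
        ((((vv_comm 𝒢 hcen hTc).pow_left (N * k)).pow_right M).inv_left).eq.symm
      rw [hcomm] at hM
      have h1 : (Q * T ^ (N * k))⁻¹ * vv 𝒢 p N x ^ (j0 + M) ∈ 𝒢.pos := by
        rw [← hQv]
        exact memEq (mul_mem hM hRpos) (by group)
      have h2 : Q⁻¹ * 𝒢.Δ ^ ((j0 * (N * r) : ℕ) : ℤ) ∈ 𝒢.pos := by
        refine memEq (mul_mem hRpos (vv_sup 𝒢 hcen hx j0)) ?_
        rw [hQdef]; group
      have h3 : (Q * T ^ (N * k))⁻¹ * 𝒢.Δ ^ (((j0 + k * (a + 1)) * (N * r) : ℕ) : ℤ) ∈ 𝒢.pos := by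
        have hsup' := delta_swap' 𝒢 _ hsup
        refine memEq (mul_mem hsup' (cj_mem 𝒢 (-((N * k * ((a + 1) * r) : ℕ) : ℤ)) h2)) ?_
        have : (((j0 + k * (a + 1)) * (N * r) : ℕ) : ℤ) =
          ((j0 * (N * r) : ℕ) : ℤ) + ((N * k * ((a + 1) * r) : ℕ) : ℤ) := by push_cast; ring
        rw [this]
        generalize ((j0 * (N * r) : ℕ) : ℤ) = e1
        generalize ((N * k * ((a + 1) * r) : ℕ) : ℤ) = e2
        rw [zpow_add]
        group
      have h4 := D.d_nonneg (hA _ _ _ h1 h3)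
      have h5 := D.d_nonneg hQ
      rw [D.d_mul, D.d_inv, D.d_mul, D.d_pow, D.d_pow, hdv] at h4
      linarith
    have h1 := hbd (j0 * δ.toNat + 1)
    have hδ' : δ ≤ δ.toNat := Int.self_le_toNat δ
    have hN' : (1 : ℤ) ≤ N := by exact_mod_cast hN
    have h2 : D.d T ≥ (a + 1) * δ + 1 := by linarith
    push_cast at h1
    have h3 : ((j0 : ℤ) * δ.toNat + 1) * D.d T ≤ (j0 + (j0 * δ.toNat + 1) * (a + 1)) * δ := by
      have : (N : ℤ) * (((j0 : ℤ) * δ.toNat + 1) * D.d T) ≤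
        N * ((j0 + (j0 * δ.toNat + 1) * (a + 1)) * δ) := by linarith
      exact le_of_mul_le_mul_left this (by linarith)
    have h4 : ((j0 : ℤ) * δ.toNat + 1) * ((a + 1) * δ + 1) ≤ ((j0 : ℤ) * δ.toNat + 1) * D.d T :=
      mul_le_mul_of_nonneg_left h2 (by positivity)
    have h5 : (j0 : ℤ) * δ ≤ j0 * δ.toNat := mul_le_mul_of_nonneg_left hδ' (by positivity)
    linarith
  -- growth
  have hgrow : ∀ {k : ℕ} {U U' : G}, IsR 𝒢 p N y k U → IsR 𝒢 p N y (k + r) U' →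
      D.d U + δ ≤ D.d U' := by
    intro k U U' h h'
    have h1 := D.d_nonneg (isR_grow 𝒢 hcen hN hy h h')
    simp only [D.d_mul, D.d_inv, D.d_zpow] at h1
    rw [hdy] at h1
    rw [hδ]
    linarith
  obtain ⟨R1, hR1⟩ := exists_isR (N := N) 𝒢 D hy r
  have hsum : ∀ (b : ℕ) (U : G), IsR 𝒢 p N y ((b + 1) * r) U → D.d R1 + b * δ ≤ D.d U := by
    intro b
    induction b with
    | zero =>
      intro U hU
      have : U = R1 := isR_unique 𝒢 hU (by simpa using hR1)
      simp [this]
    | succ b ih =>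
      intro U hU
      obtain ⟨V, hV⟩ := exists_isR (N := N) 𝒢 D hy ((b + 1) * r)
      have h1 := ih V hV
      have h2 := hgrow hV (by convert hU using 1; ring)
      push_cast
      linarith
  have hR1le : D.d R1 ≤ δ := by
    have := hsum a T hT
    linarith
  have h0 := isR_grow 𝒢 hcen hN hy (isR_zero 𝒢 y) (by simpa using hR1)
  have hR1eq : R1 = 𝒢.Δ ^ (-p) * y := by
    have := D.eq_one h0 (by
      simp only [D.d_mul, D.d_inv, D.d_zpow, D.d_one]
      rw [hdy]
      linarith)
    rw [mul_inv_eq_one] at this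
    simpa using this
  refine ⟨R, hy, hR1eq ▸ hR1, ?_⟩
  rintro ⟨M, hM⟩
  rw [← hydef] at hM
  apply hB (j0 + M)
  rw [← hQv]
  have h1 := cj_mem 𝒢 (-1) (mul_mem (mul_mem hQ hM) (cj_mem 𝒢 1 hRpos))
  exact memEq h1 (by group)

lemma leftRigid_to_right (D : Deg 𝒢) {x : G} (hx : 𝒢.LeftRigid x) :
    ∃ y, IsConj x y ∧ 𝒢.RightRigid y := by
  obtain ⟨p, r, hadm, hδ, hAB⟩ := rigid_data 𝒢 D hx
  obtain ⟨N, hN, hcenN⟩ := Deg.exists_central D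
  have hcen : ∀ g : G, Commute (𝒢.Δ ^ ((N : ℤ) * p)) g := by
    intro g
    rw [zpow_mul]
    exact (hcenN g).zpow_left p
  obtain ⟨hA, hB⟩ := hAB N hcen
  obtain ⟨R, hy, hRy, hΔ⟩ := core 𝒢 D hN hcen hadm hA hB
  refine ⟨R * x * R⁻¹, isConj_iff.2 ⟨R, rfl⟩, ?_⟩
  have hdy : D.d (R * x * R⁻¹) = D.d x := D.d_conj _ _
  rw [← hdy] at hδ
  generalize R * x * R⁻¹ = y at *
  have hR1pos := isR_pos 𝒢 hRy
  have hl : IsLeftNF 𝒢.pos 𝒢.Δ 𝒢.gcdL (𝒢.lnf y).1 (𝒢.lnf y).2 y :=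
    Classical.choose_spec (𝒢.lnf_exists y)
  have hm : IsRightNF 𝒢.pos 𝒢.Δ 𝒢.gcdR (𝒢.rnf y).1 (𝒢.rnf y).2 y :=
    Classical.choose_spec (𝒢.rnf_exists y)
  obtain ⟨hpq, hlen⟩ := 𝒢.lnf_rnf_agree y _ _ _ _ hl hm
  unfold GarsideGroup.RightRigid GarsideGroup.iotaR GarsideGroup.tau
  generalize (𝒢.lnf y).1 = q at *
  generalize (𝒢.lnf y).2 = l at *
  generalize (𝒢.rnf y).1 = q' at *
  generalize (𝒢.rnf y).2 = m at *
  subst hpq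
  obtain ⟨hyl, hlp, hlc⟩ := hl
  obtain ⟨hym, hmp, hmc⟩ := hm
  have hlc' := List.IsChain.imp (fun _ _ h => wt_of_gcd 𝒢 h) hlc
  have hls : ∀ s ∈ l, Simple 𝒢.pos 𝒢.Δ s := fun s hs => (hlp s hs).1
  have hlpos : l.prod ∈ 𝒢.pos := Submonoid.list_prod_mem _ fun s hs => (hls s hs).1
  have hqp : q = p := by
    rcases lt_trichotomy q p with h | h | h
    · exfalso
      obtain ⟨k, hk⟩ := Int.eq_ofNat_of_zero_le (show 0 ≤ p - q - 1 by omega)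
      have h1 : 𝒢.Δ⁻¹ * l.prod ∈ 𝒢.pos := by
        refine memEq (mul_mem (dpow_mem 𝒢 k) hR1pos) ?_
        have : (k : ℤ) = p - q - 1 := by omega
        rw [hyl, this]; group
      cases l with
      | nil => exact delta_ne_one 𝒢 (𝒢.pos_antisymm _ 𝒢.Δ_pos (by simpa using h1))
      | cons a l =>
        have h2 := dvd_head 𝒢 l a 𝒢.Δ hlc' hls h1 (by simp)
        obtain ⟨h3, _, h4⟩ := hlp a (by simp)
        exact h4 (inv_mul_eq_one.1 (𝒢.pos_antisymm _ h3.2 (memEq h2 (by group))))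
    · exact h
    · exfalso
      apply hΔ
      obtain ⟨k, hk⟩ := Int.eq_ofNat_of_zero_le (show 0 ≤ q - p - 1 by omega)
      obtain ⟨M, hM⟩ := hRy.1
      refine ⟨M, memEq (mul_mem hM (mul_mem (dpow_mem 𝒢 k) (cj_mem 𝒢 1 hlpos))) ?_⟩
      have : (k : ℤ) = q - p - 1 := by omega
      rw [hyl, this]; group
  subst hqp
  have hmlen : m.length ≤ r := by
    rw [← hlen]
    by_contra hgt
    push Not at hgt
    have h1 : l.prod⁻¹ * 𝒢.Δ ^ (r : ℤ) ∈ 𝒢.pos := by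
      refine memEq hy.2 ?_
      rw [hyl, zpow_add]; group
    have hsplit := List.take_append_drop r l
    have htl : (l.take r).length = r := by rw [List.length_take]; omega
    have h2 := dvd_take 𝒢 (l.take r) (l.drop r) l.prod (by rw [hsplit]; exact hlc')
      (by rw [hsplit]; exact hls) (by rw [hsplit]; simp) (by rw [htl]; exact h1)
    have h3 : (l.drop r).prod⁻¹ ∈ 𝒢.pos := by
      have hp : l.prod = (l.take r).prod * (l.drop r).prod := by
        rw [← List.prod_append, hsplit]
      refine memEq h2 ?_
      rw [hp]; group
    have h4 := D.d_nonneg h3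
    rw [D.d_inv] at h4
    cases hdr : l.drop r with
    | nil =>
      have := congrArg List.length hdr
      rw [List.length_drop] at this
      simp at this
      omega
    | cons a l' =>
      have hsub : ∀ s ∈ a :: l', s ∈ l := fun s hs => List.mem_of_mem_drop (hdr ▸ hs)
      rw [hdr, List.prod_cons, D.d_mul] at h4
      have h5 := hlp a (hsub a (by simp))
      have h6 := D.d_pos a h5.1.1 h5.2.1
      have h7 := D.d_nonneg (Submonoid.list_prod_mem 𝒢.pos
        fun s (hs : s ∈ l') => (hls s (hsub s (by simp [hs]))).1)
      omega
  have hmne : m ≠ [] := by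
    rintro rfl
    rw [hym] at hδ
    simp [D.d_zpow] at hδ
  obtain ⟨m₀, b, hmb⟩ : ∃ m₀ b, m = m₀ ++ [b] :=
    ⟨m.dropLast, m.getLast hmne, (List.dropLast_append_getLast hmne).symm⟩
  have hb : (m.getLast?).getD 1 = b := by rw [hmb]; simp
  rw [hb]
  have hbp := hmp b (by rw [hmb]; simp)
  have hm₀pos : m₀.prod ∈ 𝒢.pos :=
    Submonoid.list_prod_mem _ fun s hs => (hmp s (by rw [hmb]; simp [hs])).1.1
  have hι : Simple 𝒢.pos 𝒢.Δ (𝒢.Δ ^ (-q) * b * 𝒢.Δ ^ q) := by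
    have := simple_cjk 𝒢 (-q) hbp.1
    rwa [neg_neg] at this
  set ι := 𝒢.Δ ^ (-q) * b * 𝒢.Δ ^ q with hιdef
  refine ⟨hmne, ?_, ?_, ?_⟩
  · rw [hym, List.prod_cons]; group
  · intro s hs
    rw [List.mem_cons] at hs
    rcases hs with rfl | hs
    · refine ⟨hι, ?_, ?_⟩
      · intro h
        apply hbp.2.1
        calc b = 𝒢.Δ ^ q * (𝒢.Δ ^ (-q) * b * 𝒢.Δ ^ q) * 𝒢.Δ ^ (-q) := by group
          _ = 1 := by rw [← hιdef, h]; group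
      · intro h
        apply hbp.2.2
        calc b = 𝒢.Δ ^ q * (𝒢.Δ ^ (-q) * b * 𝒢.Δ ^ q) * 𝒢.Δ ^ (-q) := by group
          _ = 𝒢.Δ := by rw [← hιdef, h]; group
    · exact hmp s hs
  · have goal : ∀ z ∈ m.head?, 𝒢.gcdR (ι * z) 𝒢.Δ = z := by
      intro z hz
      obtain ⟨m', hm'⟩ : ∃ m', m = z :: m' := by
        cases m with
        | nil => exact absurd rfl hmne
        | cons a m' =>
          have : a = z := by simpa using hz
          exact ⟨m', by rw [this]⟩
      have hzs := (hmp z (by rw [hm']; simp)).1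
      have hms : ∀ s ∈ m', Simple 𝒢.pos 𝒢.Δ s := fun s hs => (hmp s (by rw [hm']; simp [hs])).1
      set c := 𝒢.gcdR (ι * z) 𝒢.Δ with hc
      have c1 : ι * z * c⁻¹ ∈ 𝒢.pos := 𝒢.gcdR_dvd_left _ _
      have c2 : 𝒢.Δ * c⁻¹ ∈ 𝒢.pos := 𝒢.gcdR_dvd_right _ _
      have c3 : c * z⁻¹ ∈ 𝒢.pos := 𝒢.dvd_gcdR _ _ _ (memEq hι.1 (by group))
        ((𝒢.divisors_Δ z).1 hzs).2
      have hyz : y = z * m'.prod * 𝒢.Δ ^ q := by rw [hym, hm', List.prod_cons]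
      have hyb : y = m₀.prod * b * 𝒢.Δ ^ q := by rw [hym, hmb, List.prod_append]; simp
      have c4 := hRy.2.2 (𝒢.Δ ^ (-q) * (c * m'.prod) * 𝒢.Δ ^ q) ?_ ?_
      · have c5 := cj_mem 𝒢 q c4
        have c6 : z * c⁻¹ ∈ 𝒢.pos := by
          refine memEq c5 ?_
          rw [hyz]; group
        have := 𝒢.pos_antisymm _ c6 (memEq c3 (by group))
        exact (mul_inv_eq_one.1 this).symm
      · obtain ⟨M, hM⟩ := suf_grow 𝒢 hN hcen hy hRy.1
        refine ⟨M, ?_⟩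
        have e0 : 𝒢.Δ ^ (-q) * m₀.prod * 𝒢.Δ ^ q ∈ 𝒢.pos := by
          have := cj_mem 𝒢 (-q) hm₀pos
          rwa [neg_neg] at this
        have := cj_mem 𝒢 (-q) (mul_mem e0 c1)
        have hy1 : 𝒢.Δ ^ (-q) * y = (𝒢.Δ ^ (-q) * m₀.prod * 𝒢.Δ ^ q) * ι := by
          rw [hyb, hιdef]; group
        generalize vv 𝒢 q N y ^ M = V at hM ⊢
        rw [hy1, hyz] at hM
        exact memEq (mul_mem hM this) (by group)
      · have e1 := prod_sup 𝒢 m' hms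
        have e2 := delta_swap 𝒢 _ e1
        obtain ⟨k, hk⟩ := Nat.exists_eq_add_of_le hmlen
        have hr : (r : ℤ) = k + (m'.length + 1) := by
          rw [hk, hm', List.length_cons]; push_cast; ring
        have e3 := mul_mem (dpow_mem 𝒢 k) (mul_mem (cj_mem 𝒢 1 e2) c2)
        exact memEq (cj_mem 𝒢 (-q) e3) (by rw [hr]; group)
    exact List.isChain_cons.2 ⟨goal, hmc⟩

end Helpers

end Garside

namespace Garside

section Opposite

open MulOpposite

variable {G : Type*} [Group G] (𝒢 : GarsideGroup G)

lemma op_simple (s : Gᵐᵒᵖ) :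
    Simple 𝒢.pos.op (op 𝒢.Δ) s ↔ Simple 𝒢.pos 𝒢.Δ (unop s) :=
  (𝒢.divisors_Δ (unop s)).symm

lemma op_proper (l : List Gᵐᵒᵖ) :
    (∀ s ∈ l, Simple 𝒢.pos.op (op 𝒢.Δ) s ∧ s ≠ 1 ∧ s ≠ op 𝒢.Δ) ↔
    ∀ s ∈ (l.map unop).reverse, Simple 𝒢.pos 𝒢.Δ s ∧ s ≠ 1 ∧ s ≠ 𝒢.Δ := by
  simp only [List.mem_reverse, List.mem_map, forall_exists_index, and_imp,
    forall_apply_eq_imp_iff₂]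
  refine forall₂_congr fun s _ => ?_
  rw [op_simple, Ne, Ne, Ne, Ne, unop_eq_one_iff,
    ← unop_inj (x := s) (y := op 𝒢.Δ), unop_op]

lemma op_leftNF (p : ℤ) (l : List Gᵐᵒᵖ) (x : Gᵐᵒᵖ) :
    IsLeftNF 𝒢.pos.op (op 𝒢.Δ) (fun a b => op (𝒢.gcdR (unop a) (unop b))) p l x ↔
    IsRightNF 𝒢.pos 𝒢.Δ 𝒢.gcdR p (l.map unop).reverse (unop x) := by
  unfold IsLeftNF IsRightNF
  rw [op_proper]
  refine and_congr ?_ (and_congr Iff.rfl ?_)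
  · rw [← unop_inj, unop_mul, unop_zpow, unop_op, unop_list_prod]
  · change l.IsChain _ ↔ List.IsChain _ _
    rw [List.isChain_reverse, List.isChain_map]
    exact List.IsChain.iff fun a b => by rw [← unop_inj]; rfl

lemma op_rightNF (p : ℤ) (l : List Gᵐᵒᵖ) (x : Gᵐᵒᵖ) :
    IsRightNF 𝒢.pos.op (op 𝒢.Δ) (fun a b => op (𝒢.gcdL (unop a) (unop b))) p l x ↔
    IsLeftNF 𝒢.pos 𝒢.Δ 𝒢.gcdL p (l.map unop).reverse (unop x) := by
  unfold IsLeftNF IsRightNF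
  rw [op_proper]
  refine and_congr ?_ (and_congr Iff.rfl ?_)
  · rw [← unop_inj, unop_mul, unop_zpow, unop_op, unop_list_prod]
  · change l.IsChain _ ↔ List.IsChain _ _
    rw [List.isChain_reverse, List.isChain_map]
    exact List.IsChain.iff fun a b => by rw [← unop_inj]; rfl

lemma rev_inj {l m : List Gᵐᵒᵖ} (h : (l.map unop).reverse = (m.map unop).reverse) : l = m :=
  List.map_injective_iff.2 unop_injective (List.reverse_injective h)

lemma rev_op (l : List G) : (((l.map op).reverse).map unop).reverse = l := by
  simp [List.map_reverse, Function.comp_def]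

/-- The opposite Garside structure. -/
def opG : GarsideGroup Gᵐᵒᵖ where
  pos := 𝒢.pos.op
  pos_antisymm a h1 h2 := unop_injective (𝒢.pos_antisymm (unop a) h1 h2)
  Δ := op 𝒢.Δ
  Δ_pos := 𝒢.Δ_pos
  gcdL a b := op (𝒢.gcdR (unop a) (unop b))
  gcdL_dvd_left a b := 𝒢.gcdR_dvd_left (unop a) (unop b)
  gcdL_dvd_right a b := 𝒢.gcdR_dvd_right (unop a) (unop b)
  dvd_gcdL a b c h1 h2 := 𝒢.dvd_gcdR (unop a) (unop b) (unop c) h1 h2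
  lcmL a b := op (𝒢.lcmR (unop a) (unop b))
  dvd_lcmL_left a b := 𝒢.dvd_lcmR_left (unop a) (unop b)
  dvd_lcmL_right a b := 𝒢.dvd_lcmR_right (unop a) (unop b)
  lcmL_dvd a b c h1 h2 := 𝒢.lcmR_dvd (unop a) (unop b) (unop c) h1 h2
  gcdR a b := op (𝒢.gcdL (unop a) (unop b))
  gcdR_dvd_left a b := 𝒢.gcdL_dvd_left (unop a) (unop b)
  gcdR_dvd_right a b := 𝒢.gcdL_dvd_right (unop a) (unop b)
  dvd_gcdR a b c h1 h2 := 𝒢.dvd_gcdL (unop a) (unop b) (unop c) h1 h2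
  lcmR a b := op (𝒢.lcmL (unop a) (unop b))
  dvd_lcmR_left a b := 𝒢.dvd_lcmL_left (unop a) (unop b)
  dvd_lcmR_right a b := 𝒢.dvd_lcmL_right (unop a) (unop b)
  lcmR_dvd a b c h1 h2 := 𝒢.lcmL_dvd (unop a) (unop b) (unop c) h1 h2
  divisors_Δ s := (𝒢.divisors_Δ (unop s)).symm
  simples_generate := by
    have h : {s : Gᵐᵒᵖ | Simple 𝒢.pos.op (op 𝒢.Δ) s} = unop ⁻¹' {s : G | Simple 𝒢.pos 𝒢.Δ s} := by
      ext s; exact op_simple 𝒢 s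
    rw [h, ← Subgroup.op_closure, 𝒢.simples_generate, Subgroup.op_top]
  lnf_exists x := by
    obtain ⟨⟨p, l⟩, h⟩ := 𝒢.rnf_exists (unop x)
    exact ⟨(p, (l.map op).reverse), (op_leftNF 𝒢 _ _ _).2 (by rw [rev_op]; exact h)⟩
  lnf_unique x p q l m h1 h2 := by
    obtain ⟨h, h'⟩ := 𝒢.rnf_unique _ _ _ _ _ ((op_leftNF 𝒢 _ _ _).1 h1) ((op_leftNF 𝒢 _ _ _).1 h2)
    exact ⟨h, rev_inj h'⟩
  rnf_exists x := by
    obtain ⟨⟨p, l⟩, h⟩ := 𝒢.lnf_exists (unop x)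
    exact ⟨(p, (l.map op).reverse), (op_rightNF 𝒢 _ _ _).2 (by rw [rev_op]; exact h)⟩
  rnf_unique x p q l m h1 h2 := by
    obtain ⟨h, h'⟩ := 𝒢.lnf_unique _ _ _ _ _ ((op_rightNF 𝒢 _ _ _).1 h1) ((op_rightNF 𝒢 _ _ _).1 h2)
    exact ⟨h, rev_inj h'⟩
  lnf_rnf_agree x p q l m h1 h2 := by
    obtain ⟨h, h'⟩ := 𝒢.lnf_rnf_agree _ _ _ _ _
      ((op_rightNF 𝒢 _ _ _).1 h2) ((op_leftNF 𝒢 _ _ _).1 h1)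
    exact ⟨h.symm, by simpa using h'.symm⟩

/-- The degree function on the opposite group. -/
def opDeg (D : Deg 𝒢) : Deg (opG 𝒢) where
  d a := D.d (unop a)
  d_mul a b := by rw [unop_mul, D.d_mul, add_comm]
  d_pos a h h1 := D.d_pos (unop a) h (by rwa [Ne, unop_eq_one_iff])
  fin k := (D.fin k).preimage unop_injective.injOn

lemma op_lnf (x : Gᵐᵒᵖ) : 𝒢.rnf (unop x) =
    (((opG 𝒢).lnf x).1, (((opG 𝒢).lnf x).2.map unop).reverse) := by
  have h1 : IsRightNF 𝒢.pos 𝒢.Δ 𝒢.gcdR _ _ (unop x) :=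
    (op_leftNF 𝒢 _ _ _).1 (Classical.choose_spec ((opG 𝒢).lnf_exists x))
  have h2 := Classical.choose_spec (𝒢.rnf_exists (unop x))
  have := 𝒢.rnf_unique _ _ _ _ _ h2 h1
  exact Prod.ext this.1 this.2

lemma op_rnf (x : Gᵐᵒᵖ) : 𝒢.lnf (unop x) =
    (((opG 𝒢).rnf x).1, (((opG 𝒢).rnf x).2.map unop).reverse) := by
  have h1 : IsLeftNF 𝒢.pos 𝒢.Δ 𝒢.gcdL _ _ (unop x) :=
    (op_rightNF 𝒢 _ _ _).1 (Classical.choose_spec ((opG 𝒢).rnf_exists x))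
  have h2 := Classical.choose_spec (𝒢.lnf_exists (unop x))
  have := 𝒢.lnf_unique _ _ _ _ _ h2 h1
  exact Prod.ext this.1 this.2

lemma op_tau (k : ℤ) (x : Gᵐᵒᵖ) : unop ((opG 𝒢).tau k x) = 𝒢.tau (-k) (unop x) := by
  unfold GarsideGroup.tau
  change 𝒢.Δ ^ k * (unop x * 𝒢.Δ ^ (-k)) = _
  rw [neg_neg, mul_assoc]

lemma op_iotaL (x : Gᵐᵒᵖ) : unop ((opG 𝒢).iotaL x) = 𝒢.iotaR (unop x) := by
  unfold GarsideGroup.iotaL GarsideGroup.iotaR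
  rw [op_tau, op_lnf]
  cases ((opG 𝒢).lnf x).2 <;> simp

lemma op_iotaR (x : Gᵐᵒᵖ) : unop ((opG 𝒢).iotaR x) = 𝒢.iotaL (unop x) := by
  unfold GarsideGroup.iotaL GarsideGroup.iotaR
  rw [op_tau, op_rnf]
  rcases List.eq_nil_or_concat ((opG 𝒢).rnf x).2 with h | ⟨l, b, h⟩ <;> simp [h]

lemma op_leftRigid (x : Gᵐᵒᵖ) : (opG 𝒢).LeftRigid x ↔ 𝒢.RightRigid (unop x) := by
  unfold GarsideGroup.LeftRigid GarsideGroup.RightRigid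
  refine and_congr (by rw [op_lnf]; simp) ?_
  refine (op_leftNF 𝒢 _ _ _).trans ?_
  rw [← op_iotaL, op_lnf, List.map_append, List.reverse_append, unop_mul]
  rfl

lemma op_rightRigid (x : Gᵐᵒᵖ) : (opG 𝒢).RightRigid x ↔ 𝒢.LeftRigid (unop x) := by
  unfold GarsideGroup.LeftRigid GarsideGroup.RightRigid
  refine and_congr (by rw [op_rnf]; simp) ?_
  refine (op_rightNF 𝒢 _ _ _).trans ?_
  rw [← op_iotaR, op_rnf, List.map_cons, List.reverse_cons, unop_mul]

lemma rightRigid_to_left (D : Deg 𝒢) {x : G} (hx : 𝒢.RightRigid x) :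
    ∃ y, IsConj x y ∧ 𝒢.LeftRigid y := by
  obtain ⟨y, h1, h2⟩ := leftRigid_to_right (opG 𝒢) (opDeg 𝒢 D) ((op_leftRigid 𝒢 (op x)).2 hx)
  refine ⟨unop y, ?_, (op_rightRigid 𝒢 y).1 h2⟩
  obtain ⟨c, hc⟩ := isConj_iff.1 h1
  refine isConj_iff.2 ⟨unop c⁻¹, ?_⟩
  rw [← hc]
  simp [mul_assoc]

end Opposite

section Braid

/-- The exponent sum homomorphism. -/
def expHom (n : ℕ) : BraidGroup n →* Multiplicative ℤ :=
  PresentedGroup.toGroup (rels := braidRels (n - 1)) (f := fun _ => Multiplicative.ofAdd 1) (by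
    rintro r (⟨i, j, -, rfl⟩ | ⟨i, j, -, rfl⟩) <;> simp)

lemma expHom_σ (n : ℕ) (i : Fin (n - 1)) : expHom n (σB n i) = Multiplicative.ofAdd 1 := by
  unfold expHom σB
  exact PresentedGroup.toGroup.of _

lemma pos_list {n : ℕ} {a : BraidGroup n} (ha : a ∈ Submonoid.closure (Set.range (σB n))) :
    ∃ l : List (Fin (n - 1)), a = (l.map (σB n)).prod ∧
      (expHom n a).toAdd = l.length := by
  have : ∃ l : List (Fin (n - 1)), a = (l.map (σB n)).prod := by
    induction ha using Submonoid.closure_induction with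
    | mem x hx => obtain ⟨i, rfl⟩ := hx; exact ⟨[i], by simp⟩
    | one => exact ⟨[], by simp⟩
    | mul x y _ _ hx hy =>
      obtain ⟨l, rfl⟩ := hx
      obtain ⟨m, rfl⟩ := hy
      exact ⟨l ++ m, by simp⟩
  obtain ⟨l, rfl⟩ := this
  refine ⟨l, rfl, ?_⟩
  clear ha
  induction l with
  | nil => simp
  | cons i l ih =>
    rw [List.map_cons, List.prod_cons, map_mul, toAdd_mul, ih, expHom_σ]
    simp [add_comm]

/-- The exponent sum as a degree function on the braid group. -/
def braidDeg {n : ℕ} (𝒢 : GarsideGroup (BraidGroup n)) (h𝒢 : IsBraidGarside n 𝒢) : Deg 𝒢 where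
  d a := (expHom n a).toAdd
  d_mul a b := by rw [map_mul, toAdd_mul]
  d_pos a h h1 := by
    rw [h𝒢.1] at h
    obtain ⟨l, rfl, hl⟩ := pos_list h
    rw [hl]
    cases l with
    | nil => exact absurd rfl h1
    | cons i l => simp
  fin k := by
    rw [h𝒢.1]
    refine ((List.finite_length_le (Fin (n - 1)) k.toNat).image
      fun l => (l.map (σB n)).prod).subset ?_
    rintro a ⟨h, hk⟩
    obtain ⟨l, hl, hl'⟩ := pos_list h
    refine ⟨l, ?_, hl.symm⟩
    rw [hl'] at hk
    change l.length ≤ k.toNat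
    omega

end Braid

end Garside


namespace Garside

/-- **Theorem 2.** A braid `x ∈ Bₙ` with `ℓ(x) > 1` is conjugate to a left
rigid braid if and only if it is conjugate to a right rigid braid. -/
theorem conj_leftRigid_iff_conj_rightRigid {n : ℕ} (𝒢 : GarsideGroup (BraidGroup n))
    (h𝒢 : IsBraidGarside n 𝒢) (x : BraidGroup n) (hx : 1 < 𝒢.len x) :
    (∃ y, IsConj x y ∧ 𝒢.LeftRigid y) ↔ (∃ y, IsConj x y ∧ 𝒢.RightRigid y) := by
  constructor
  · rintro ⟨y, h1, h2⟩
    obtain ⟨z, h3, h4⟩ := leftRigid_to_right 𝒢 (braidDeg 𝒢 h𝒢) h2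
    exact ⟨z, h1.trans h3, h4⟩
  · rintro ⟨y, h1, h2⟩
    obtain ⟨z, h3, h4⟩ := rightRigid_to_left 𝒢 (braidDeg 𝒢 h𝒢) h2
    exact ⟨z, h1.trans h3, h4⟩

end Garside
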